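/- Let μ be a spreadable Borel probability measure on 𝕋^ℤ, and suppose μ = t·ν₁ + (1−t)·ν₂ where 0 < t < 1 and ν₁, ν₂ are shift-invariant Borel probability measures on 𝕋^ℤ. Then ν₁ and ν₂ are spreadable. In other words, the convex set of spreadable probability measures is a face of the convex set of shift-invariant probability measures on 𝕋^ℤ. -/

import Mathlib

open MeasureTheory
open scoped ENNReal

noncomputable instance : MeasurableSpace Circle := borel Circle
instance : BorelSpace Circle := ⟨rfl⟩

/-- A Borel probability measure on `𝕋^ℤ` is spreadable if it is invariant under the
action `x ↦ x ∘ h` of every strictly increasing map `h : ℤ → ℤ`. -/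
def Spreadable (μ : Measure (ℤ → Circle)) : Prop :=
  ∀ h : ℤ → ℤ, StrictMono h → Measure.map (fun x => x ∘ h) μ = μ

/-- The shift on `𝕋^ℤ`: `(τ x)(l) = x(l+1)`. -/
def circleShift : (ℤ → Circle) → (ℤ → Circle) := fun x l => x (l + 1)

section SequenceSpace

variable {E : Type*} [MeasurableSpace E]

theorem measurable_comp_right {ι κ : Type*} (h : κ → ι) :
    Measurable (fun x : ι → E => x ∘ h) :=
  measurable_pi_iff.2 fun i => measurable_pi_apply (h i)

theorem cylinderEvents_le_comap_domRestrict {ι : Type*} (s : Set ι) :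
    cylinderEvents (X := fun _ : ι => E) s ≤ MeasurableSpace.comap s.domRestrict inferInstance := by
  refine iSup₂_le fun i hi => ?_
  have h : (fun x : ι → E => x i) = (fun y : s → E => y ⟨i, hi⟩) ∘ s.domRestrict := rfl
  rw [h, ← MeasurableSpace.comap_comp]
  exact MeasurableSpace.comap_mono (measurable_pi_apply _).comap_le

/-- A function measurable for the events on `s` depends only on the coordinates in `s`. -/
theorem apply_eq_of_stronglyMeasurable_cylinderEvents {ι : Type*} {s : Set ι}
    {F : (ι → E) → ℝ} (hF : StronglyMeasurable[cylinderEvents s] F) {x y : ι → E}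
    (hxy : ∀ i ∈ s, x i = y i) : F x = F y :=
  (hF.mono (cylinderEvents_le_comap_domRestrict s)).factorsThrough (f := s.domRestrict)
    (funext fun i => hxy i i.2)

theorem mem_iff_of_measurableSet_cylinderEvents {ι : Type*} {s : Set ι} {A : Set (ι → E)}
    (hA : MeasurableSet[cylinderEvents s] A) {x y : ι → E} (hxy : ∀ i ∈ s, x i = y i) :
    x ∈ A ↔ y ∈ A := by
  obtain ⟨B, -, rfl⟩ := cylinderEvents_le_comap_domRestrict s A hA
  have h : s.domRestrict x = s.domRestrict y := funext fun i => hxy i i.2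
  simp [h]

theorem iSup_cylinderEvents {ι κ : Type*} {s : κ → Set ι} (hs : ∀ i, ∃ k, i ∈ s k) :
    ⨆ k, cylinderEvents (X := fun _ : ι => E) (s k) = MeasurableSpace.pi := by
  refine le_antisymm (iSup_le fun _ => cylinderEvents_le_pi) (iSup_le fun i => ?_)
  obtain ⟨k, hk⟩ := hs i
  exact le_iSup_of_le k (le_iSup₂_of_le i hk le_rfl)

/-- The filtration on `E^ℤ` generated by the coordinates `l ≥ -n`. -/
def coordinateFiltration (E : Type*) [MeasurableSpace E] :
    Filtration ℕ (MeasurableSpace.pi (X := fun _ : ℤ => E)) where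
  seq n := cylinderEvents (Set.Ici (-(n : ℤ)))
  mono' _ _ hmn := cylinderEvents_mono (Set.Ici_subset_Ici.2 (by omega))
  le' _ := cylinderEvents_le_pi

theorem ae_eq_comp_add_natCast {μ : Measure (ℤ → E)} {f : (ℤ → E) → ℝ}
    (hμ : MeasurePreserving (fun x : ℤ → E => x ∘ (· + 1)) μ μ)
    (hf : (fun x => f (x ∘ (· + 1))) =ᵐ[μ] f) (m : ℕ) :
    (fun x => f (x ∘ (· + (m : ℤ)))) =ᵐ[μ] f := by
  induction m with
  | zero =>
    refine Filter.Eventually.of_forall fun x => ?_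
    simp [Function.comp_def]
  | succ m ih =>
    refine Filter.EventuallyEq.trans ?_ ((hμ.quasiMeasurePreserving.ae_eq_comp ih).trans hf)
    refine Filter.Eventually.of_forall fun x => ?_
    simp [Function.comp_def, add_assoc]

/-- A shift-invariant integrable function is invariant under each spreading which is eventually
a translation. -/
theorem comp_spreading_ae_eq {μ : Measure (ℤ → E)} [IsFiniteMeasure μ]
    (hμ : ∀ h : ℤ → ℤ, StrictMono h → MeasurePreserving (fun x : ℤ → E => x ∘ h) μ μ)
    {f : (ℤ → E) → ℝ} (hfm : Measurable f) (hfi : Integrable f μ)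
    (hf : (fun x => f (x ∘ (· + 1))) =ᵐ[μ] f)
    {h : ℤ → ℤ} (hh : StrictMono h) {k c : ℤ} (hc : ∀ l, k ≤ l → h l = l + c) :
    (fun x => f (x ∘ h)) =ᵐ[μ] f := by
  have hshift (m : ℕ) : MeasurePreserving (fun x : ℤ → E => x ∘ (· + (m : ℤ))) μ μ :=
    hμ _ fun _ _ hab => by simpa using hab
  have hdist {F : (ℤ → E) → ℝ} (hF : StronglyMeasurable F) (m : ℕ) :
      eLpNorm ((fun x => F (x ∘ (· + (m : ℤ)))) - f) 1 μ = eLpNorm (F - f) 1 μ := by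
    rw [← eLpNorm_comp_measurePreserving (hF.sub hfm.stronglyMeasurable).aestronglyMeasurable
      (hshift m)]
    refine eLpNorm_congr_ae ?_
    filter_upwards [ae_eq_comp_add_natCast (hμ _ fun _ _ hab => by simpa using hab) hf m]
      with x hx
    simp only [Pi.sub_apply, Function.comp_apply, hx]
  have hlim := hfi.tendsto_eLpNorm_condExp (ℱ := coordinateFiltration E) (by
    have : ⨆ n, coordinateFiltration E n = MeasurableSpace.pi :=
      iSup_cylinderEvents fun i : ℤ => ⟨i.natAbs, by simp only [Set.mem_Ici]; omega⟩
    rw [this]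
    exact hfm.stronglyMeasurable)
  have hbound (n : ℕ) : eLpNorm ((fun x => f (x ∘ h)) - f) 1 μ ≤
      eLpNorm (μ[f | coordinateFiltration E n] - f) 1 μ +
        eLpNorm (μ[f | coordinateFiltration E n] - f) 1 μ := by
    set F := μ[f | coordinateFiltration E n]
    have hF : StronglyMeasurable[cylinderEvents (Set.Ici (-(n : ℤ)))] F :=
      stronglyMeasurable_condExp
    have hF' : StronglyMeasurable F := hF.mono cylinderEvents_le_pi
    obtain ⟨M, M', hM, hMM'⟩ : ∃ M M' : ℕ, n + k ≤ M ∧ (M' : ℤ) = M + c :=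
      ⟨n + k.natAbs + c.natAbs, (n + k.natAbs + c.natAbs + c).toNat, by omega, by omega⟩
    let G : (ℤ → E) → ℝ := fun x => F (x ∘ (· + (M : ℤ)))
    have hG : StronglyMeasurable G := hF'.comp_measurable (measurable_comp_right _)
    have hGh : (fun x => G (x ∘ h)) = fun x => F (x ∘ (· + (M' : ℤ))) := by
      funext x
      refine apply_eq_of_stronglyMeasurable_cylinderEvents hF fun i hi => ?_
      have hi' : -(n : ℤ) ≤ i := hi
      simp only [Function.comp_apply]
      rw [hc _ (by omega), hMM', add_assoc]
    have hsplit : (fun x => f (x ∘ h)) - f =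
        (f - G) ∘ (fun x => x ∘ h) + ((fun x => F (x ∘ (· + (M' : ℤ)))) - f) := by
      rw [← hGh]
      funext x
      simp
    have hm : StronglyMeasurable (f - G) := hfm.stronglyMeasurable.sub hG
    have hm' : StronglyMeasurable ((fun x => F (x ∘ (· + (M' : ℤ)))) - f) :=
      (hF'.comp_measurable (measurable_comp_right _)).sub hfm.stronglyMeasurable
    rw [hsplit]
    refine (eLpNorm_add_le (hm.comp_measurable (measurable_comp_right h)).aestronglyMeasurable
      hm'.aestronglyMeasurable le_rfl).trans_eq ?_
    rw [eLpNorm_comp_measurePreserving hm.aestronglyMeasurable (hμ h hh), eLpNorm_sub_comm,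
      hdist hF' M, hdist hF' M']
  have hzero : eLpNorm ((fun x => f (x ∘ h)) - f) 1 μ = 0 :=
    le_antisymm (by simpa using ge_of_tendsto' (hlim.add hlim) hbound) zero_le
  have hm : Measurable ((fun x => f (x ∘ h)) - f) := (hfm.comp (measurable_comp_right h)).sub hfm
  rw [eLpNorm_eq_zero_iff hm.aestronglyMeasurable one_ne_zero] at hzero
  filter_upwards [hzero] with x hx
  exact sub_eq_zero.1 hx

/-- The spreading which agrees with `h` up to `k` and is a translation from `k` on. -/
theorem StrictMono.exists_eventually_translation {h : ℤ → ℤ} (hh : StrictMono h) (k : ℤ) :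
    ∃ g : ℤ → ℤ, StrictMono g ∧ (∀ l, l ≤ k → g l = h l) ∧
      ∀ l, k ≤ l → g l = l + (h k - k) := by
  refine ⟨fun l => if l ≤ k then h l else l + (h k - k), fun a b hab => ?_, fun l hl => if_pos hl,
    fun l hl => ?_⟩
  · have hab' := hh hab
    have hak : a ≤ k → h a ≤ h k := fun hak => hh.monotone hak
    dsimp only
    split_ifs <;> omega
  · obtain rfl | hl := hl.eq_or_lt
    · simp
    · exact if_neg hl.not_ge

/-- If `μ` is invariant under all spreadings, then so is every shift-invariant finite measure
which is absolutely continuous with respect to `μ`. -/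
theorem map_spreading_eq_of_absolutelyContinuous {μ ν : Measure (ℤ → E)} [IsFiniteMeasure μ]
    [IsFiniteMeasure ν]
    (hμ : ∀ h : ℤ → ℤ, StrictMono h → MeasurePreserving (fun x : ℤ → E => x ∘ h) μ μ)
    (hν : ν.map (fun x => x ∘ (· + 1)) = ν) (hνμ : ν ≪ μ) {h : ℤ → ℤ} (hh : StrictMono h) :
    ν.map (fun x => x ∘ h) = ν := by
  set f : (ℤ → E) → ℝ := fun x => (ν.rnDeriv μ x).toReal
  have hfm : Measurable f := (Measure.measurable_rnDeriv ν μ).ennreal_toReal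
  have hfi : Integrable f μ := Measure.integrable_toReal_rnDeriv
  have hofReal : (fun x => ENNReal.ofReal (f x)) =ᵐ[μ] ν.rnDeriv μ := by
    filter_upwards [Measure.rnDeriv_lt_top ν μ] with x hx
    exact ENNReal.ofReal_toReal hx.ne
  have hdens : μ.withDensity (fun x => ENNReal.ofReal (f x)) = ν := by
    rw [withDensity_congr_ae hofReal, Measure.withDensity_rnDeriv_eq ν μ hνμ]
  have hmap {g : ℤ → ℤ} (hg : StrictMono g) :
      (μ.withDensity fun x => ENNReal.ofReal (f (x ∘ g))).map (fun x => x ∘ g) = ν := by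
    ext A hA
    rw [Measure.map_apply (measurable_comp_right g) hA,
      withDensity_apply _ (measurable_comp_right g hA), ← hdens, withDensity_apply _ hA]
    exact (hμ g hg).setLIntegral_comp_preimage hA hfm.ennreal_ofReal
  have hf : (fun x => f (x ∘ (· + 1))) =ᵐ[μ] f := by
    have hinv : μ.withDensity (fun x => ENNReal.ofReal (f (x ∘ (· + 1)))) = ν := by
      have hback (ρ : Measure (ℤ → E)) :
          (ρ.map (fun x => x ∘ (· + 1))).map (fun x => x ∘ (· + -1)) = ρ := by
        rw [Measure.map_map (measurable_comp_right _) (measurable_comp_right _)]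
        simp [Function.comp_def]
      rw [← hback (μ.withDensity _), hmap fun _ _ hab => by simpa using hab]
      conv_lhs => rw [← hν]
      exact hback ν
    have hfm' : Measurable fun x => f (x ∘ (· + 1)) := hfm.comp (measurable_comp_right _)
    rw [← hdens, withDensity_eq_iff_of_sigmaFinite hfm'.ennreal_ofReal.aemeasurable
      hfm.ennreal_ofReal.aemeasurable] at hinv
    filter_upwards [hinv] with x hx
    exact (ENNReal.ofReal_eq_ofReal_iff ENNReal.toReal_nonneg ENNReal.toReal_nonneg).1 hx
  let 𝒜 : ℕ → MeasurableSpace (ℤ → E) := fun k => cylinderEvents (Set.Iic (k : ℤ))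
  have hgen : MeasurableSpace.pi = MeasurableSpace.generateFrom
      (⋃ k, {A : Set (ℤ → E) | MeasurableSet[𝒜 k] A}) := by
    refine Eq.trans ?_ (MeasurableSpace.generateFrom_iUnion_measurableSet 𝒜).symm
    exact (iSup_cylinderEvents fun i : ℤ => ⟨i.toNat, by simp only [Set.mem_Iic]; omega⟩).symm
  have hpi : IsPiSystem (⋃ k, {A : Set (ℤ → E) | MeasurableSet[𝒜 k] A}) :=
    isPiSystem_iUnion_of_monotone _ (fun k => (𝒜 k).isPiSystem_measurableSet)
      fun _ _ hab => cylinderEvents_mono (Set.Iic_subset_Iic.2 (by exact_mod_cast hab))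
  have hfin := Measure.isFiniteMeasure_map ν (fun x : ℤ → E => x ∘ h)
  refine ext_of_generate_finite _ hgen hpi (fun A hA => ?_) ?_
  · obtain ⟨k, hk⟩ := Set.mem_iUnion.1 hA
    have hA' : MeasurableSet A := cylinderEvents_le_pi A hk
    obtain ⟨g, hg, hgh, hgk⟩ := hh.exists_eventually_translation k
    have hpre : (fun x : ℤ → E => x ∘ h) ⁻¹' A = (fun x => x ∘ g) ⁻¹' A := by
      ext x
      exact mem_iff_of_measurableSet_cylinderEvents hk fun i hi => by simp [hgh i hi]
    have hνg : ν.map (fun x => x ∘ g) = ν := by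
      conv_rhs => rw [← hmap hg]
      congr 1
      rw [← hdens]
      refine withDensity_congr_ae ?_
      filter_upwards [comp_spreading_ae_eq hμ hfm hfi hf hg hgk] with x hx
      rw [hx]
    rw [Measure.map_apply (measurable_comp_right h) hA', hpre,
      ← Measure.map_apply (measurable_comp_right g) hA', hνg]
  · rw [Measure.map_apply (measurable_comp_right h) MeasurableSet.univ, Set.preimage_univ]

end SequenceSpace

theorem Spreadable.of_absolutelyContinuous {μ ν : Measure (ℤ → Circle)} [IsFiniteMeasure μ]
    [IsFiniteMeasure ν] (hμ : Spreadable μ) (hν : ν.map circleShift = ν) (hνμ : ν ≪ μ) :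
    Spreadable ν := fun _ hh =>
  map_spreading_eq_of_absolutelyContinuous
    (fun g hg => ⟨measurable_comp_right g, hμ g hg⟩) hν hνμ hh

/-- The spreadable probability measures on `𝕋^ℤ` form a face of the convex set of
shift-invariant probability measures: if a spreadable `μ` is a nontrivial convex
combination `μ = t ν₁ + (1-t) ν₂` of shift-invariant probability measures, then `ν₁`
and `ν₂` are spreadable. -/
theorem spreadable_face_of_shiftInvariant (μ ν₁ ν₂ : Measure (ℤ → Circle))
    [IsProbabilityMeasure μ] [IsProbabilityMeasure ν₁] [IsProbabilityMeasure ν₂]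
    (hμ : Spreadable μ)
    (h₁ : Measure.map circleShift ν₁ = ν₁) (h₂ : Measure.map circleShift ν₂ = ν₂)
    (t : ℝ) (ht0 : 0 < t) (ht1 : t < 1)
    (hconv : μ = ENNReal.ofReal t • ν₁ + ENNReal.ofReal (1 - t) • ν₂) :
    Spreadable ν₁ ∧ Spreadable ν₂ := by
  have hac {ν ν' : Measure (ℤ → Circle)} {a b : ℝ≥0∞} (ha : a ≠ 0) : ν ≪ a • ν + b • ν' :=
    (Measure.absolutelyContinuous_smul ha).add_right _
  refine ⟨hμ.of_absolutelyContinuous h₁ ?_, hμ.of_absolutelyContinuous h₂ ?_⟩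
  · rw [hconv]
    exact hac (by simpa using ht0)
  · rw [hconv, add_comm]
    exact hac (by simpa using ht1)
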